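/- arXiv:2504.18597 — 2 statements merged into one kernel-verified Lean document; each statement's English description precedes it below -/
import Mathlib

section
/- (Isserlis' theorem, even case.) Let k ≥ 1 and let (X_1, …, X_{2k}) be a centered Gaussian random vector in ℝ^{2k}. Then E[X_1 · X_2 ⋯ X_{2k}] = Σ_P Π_{{i,j} ∈ P} E[X_i X_j], where the sum ranges over all partitions P of the index set {1, …, 2k} into k unordered pairs. -/
open MeasureTheory ProbabilityTheory
open scoped NNReal ENNReal Classical

/-- A finite family of sets is a partition of the index set `{1, …, 2k}` (here
`Fin (2*k)`) into unordered pairs: every block has two elements, distinct blocks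
are disjoint, and the blocks cover everything. -/
def IsPairPartition {m : ℕ} (P : Finset (Finset (Fin m))) : Prop :=
  (∀ p ∈ P, p.card = 2) ∧
  (∀ p ∈ P, ∀ q ∈ P, p ≠ q → Disjoint p q) ∧
  P.biUnion id = Finset.univ

lemma iss_deriv (v : ℝ) (n : ℕ) (t : ℝ) :
    iteratedDeriv (n+2) (fun t : ℝ => Real.exp (v * t ^ 2 / 2)) t
      = v * t * iteratedDeriv (n+1) (fun t : ℝ => Real.exp (v * t ^ 2 / 2)) t
        + v * (n+1) * iteratedDeriv n (fun t : ℝ => Real.exp (v * t ^ 2 / 2)) t := by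
  have h1 : ∀ t : ℝ, HasDerivAt (fun t : ℝ => Real.exp (v * t ^ 2 / 2))
      (v * t * Real.exp (v * t ^ 2 / 2)) t := by
    intro t
    have : HasDerivAt (fun t : ℝ => v * t ^ 2 / 2) (v * t) t := by
      have := ((hasDerivAt_pow 2 t).const_mul v).div_const 2
      have he : v * (((2 : ℕ) : ℝ) * t ^ (2 - 1)) / 2 = v * t := by
        norm_num; ring
      rw [← he]; exact this
    convert this.exp using 1
    ring
  have hf : ∀ (n : ℕ) (t : ℝ), HasDerivAt (iteratedDeriv n (fun t : ℝ => Real.exp (v * t ^ 2 / 2)))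
      (iteratedDeriv (n+1) (fun t : ℝ => Real.exp (v * t ^ 2 / 2)) t) t := by
    intro n t
    rw [iteratedDeriv_succ]
    apply DifferentiableAt.hasDerivAt
    have hc : ContDiff ℝ (⊤ : ℕ∞) (fun t : ℝ => Real.exp (v * t ^ 2 / 2)) := by fun_prop
    exact (hc.differentiable_iteratedDeriv n (by exact_mod_cast WithTop.coe_lt_top _)) t
  have h1' : iteratedDeriv 1 (fun t : ℝ => Real.exp (v * t ^ 2 / 2)) =
      fun t => v * t * Real.exp (v * t ^ 2 / 2) := by
    rw [iteratedDeriv_one]; ext t; exact (h1 t).deriv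
  induction n generalizing t with
  | zero =>
    have h2 := hf 1 t
    have h3 := ((hasDerivAt_id t).const_mul v).mul (h1 t)
    rw [h1'] at h2
    have h4 := h2.unique h3
    simp only [zero_add, h1', iteratedDeriv_zero]
    rw [show (2 : ℕ) = 1 + 1 from rfl, h4]
    simp; ring
  | succ n ih =>
    have h2 := hf (n+2) t
    have h3 := (((hasDerivAt_id t).const_mul v).mul (hf (n+1) t)).add
      ((hf n t).const_mul (v * (n+1)))
    rw [funext ih] at h2
    have h4 := h2.unique h3
    rw [show n + 1 + 2 = n + 2 + 1 by ring, h4]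
    push_cast
    simp; ring

lemma iss_moment (v : ℝ≥0) (k : ℕ) :
    (∫ x, x ^ (2 * k) ∂(gaussianReal 0 v)) * (2 ^ k * (k.factorial : ℝ))
      = ((2 * k).factorial : ℝ) * (v : ℝ) ^ k := by
  have key : ∀ n : ℕ, ∫ x, x ^ n ∂(gaussianReal 0 v)
      = iteratedDeriv n (fun t : ℝ => Real.exp (v * t ^ 2 / 2)) 0 := by
    intro n
    have h := iteratedDeriv_mgf_zero (X := id) (μ := gaussianReal 0 v)
      (by rw [integrableExpSet_id_gaussianReal]; simp) n
    rw [mgf_id_gaussianReal] at h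
    simpa using h.symm
  induction k with
  | zero => simp
  | succ k ih =>
    rw [key] at ih ⊢
    rw [show 2 * (k + 1) = 2 * k + 2 by ring, iss_deriv, Nat.factorial_succ (2*k+1),
      Nat.factorial_succ (2*k), Nat.factorial_succ k]
    push_cast
    linear_combination ((v:ℝ) * (2*k+1) * 2 * (k+1)) * ih

lemma iss_polar {κ ι : Type*} [Fintype κ] [Fintype ι] [DecidableEq κ] [DecidableEq ι]
    (hc : Fintype.card κ = Fintype.card ι) (g : (κ → ι) → ℝ) :
    ∑ S : Finset ι, (-1 : ℝ) ^ (Sᶜ).card * ∑ f ∈ Fintype.piFinset (fun _ : κ => S), g f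
      = ∑ e : κ ≃ ι, g e := by
  have h1 : ∀ S : Finset ι, (-1 : ℝ) ^ (Sᶜ).card * ∑ f ∈ Fintype.piFinset (fun _ : κ => S), g f
      = ∑ f : κ → ι, if Sᶜ ⊆ (Finset.univ.image f)ᶜ then (-1 : ℝ) ^ (Sᶜ).card * g f else 0 := by
    intro S
    rw [Finset.mul_sum, ← Finset.sum_filter]
    apply Finset.sum_congr _ (fun _ _ => rfl)
    ext f
    simp [Finset.subset_iff]
  simp_rw [h1]
  rw [Finset.sum_comm]
  have h2 : ∀ f : κ → ι, (∑ S : Finset ι,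
      if Sᶜ ⊆ (Finset.univ.image f)ᶜ then (-1 : ℝ) ^ (Sᶜ).card * g f else 0)
      = if Function.Bijective f then g f else 0 := by
    intro f
    rw [Fintype.sum_bijective (compl : Finset ι → Finset ι) compl_bijective
      (fun S => if Sᶜ ⊆ (Finset.univ.image f)ᶜ then (-1 : ℝ) ^ (Sᶜ).card * g f else 0)
      (fun T => if T ⊆ (Finset.univ.image f)ᶜ then (-1 : ℝ) ^ T.card * g f else 0)
      (fun S => rfl)]
    rw [← Finset.sum_filter, ← Finset.sum_mul]
    have h3 : Finset.univ.filter (fun T => T ⊆ (Finset.univ.image f)ᶜ)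
        = ((Finset.univ.image f)ᶜ).powerset := by ext; simp
    have h4 := congrArg (Int.cast : ℤ → ℝ)
      (Finset.sum_powerset_neg_one_pow_card (x := (Finset.univ.image f)ᶜ))
    push_cast at h4
    rw [h3, h4]
    have h5 : (Finset.univ.image f)ᶜ = ∅ ↔ Function.Bijective f := by
      rw [Fintype.bijective_iff_surjective_and_card]
      simp [hc, Finset.ext_iff, Function.Surjective]
    simp only [h5]
    split_ifs <;> simp
  simp_rw [h2]
  rw [← Finset.sum_filter]
  symm
  apply Finset.sum_bij (fun (e : κ ≃ ι) _ => (e : κ → ι))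
  · intro e _; simpa using e.bijective
  · intro a _ b _ h; exact DFunLike.coe_injective h
  · intro f hf
    simp only [Finset.mem_filter, Finset.mem_univ, true_and] at hf
    exact ⟨Equiv.ofBijective f hf, Finset.mem_univ _, rfl⟩
  · intros; rfl

lemma iss_pow_one {κ ι : Type*} [Fintype κ] [DecidableEq κ] (S : Finset ι) (x : ι → ℝ) :
    (∑ i ∈ S, x i) ^ (Fintype.card κ)
      = ∑ f ∈ Fintype.piFinset (fun _ : κ => S), ∏ l, x (f l) := by
  rw [← Finset.prod_univ_sum]; simp

lemma iss_pow_two {ι : Type*} (k : ℕ) (S : Finset ι) (C : ι → ι → ℝ) :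
    (∑ i ∈ S, ∑ j ∈ S, C i j) ^ k
      = ∑ f ∈ Fintype.piFinset (fun _ : Fin k × Bool => S),
        ∏ l, C (f (l, false)) (f (l, true)) := by
  have h := iss_pow_one (κ := Fin k) (S ×ˢ S) (fun p => C p.1 p.2)
  rw [Fintype.card_fin, Finset.sum_product] at h
  rw [h]
  apply Finset.sum_nbij' (fun g q => if q.2 then (g q.1).2 else (g q.1).1)
    (fun f l => (f (l, false), f (l, true)))
  · intro g hg
    simp only [Fintype.mem_piFinset, Finset.mem_product] at hg ⊢
    rintro ⟨l, b⟩
    cases b <;> simp [hg l]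
  · intro f hf
    simp only [Fintype.mem_piFinset, Finset.mem_product] at hf ⊢
    intro l; exact ⟨hf _, hf _⟩
  · intro g _; ext l <;> simp
  · intro f _; ext ⟨l, b⟩; cases b <;> simp
  · intro g _; simp

/-- The family of blocks of an enumeration. -/
noncomputable def issBlocks {k m : ℕ} (e : Fin k × Bool ≃ Fin m) : Finset (Finset (Fin m)) :=
  Finset.univ.image (fun l => {e (l, false), e (l, true)})

lemma iss_block_mem {k m : ℕ} (e : Fin k × Bool ≃ Fin m) (l : Fin k) (x : Fin m) :
    x ∈ ({e (l, false), e (l, true)} : Finset (Fin m)) ↔ (e.symm x).1 = l := by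
  constructor
  · intro h
    simp only [Finset.mem_insert, Finset.mem_singleton] at h
    rcases h with rfl | rfl <;> simp
  · intro h
    simp only [Finset.mem_insert, Finset.mem_singleton]
    obtain ⟨⟨l', b⟩, rfl⟩ := e.surjective x
    simp at h
    subst h
    cases b <;> simp

lemma iss_block_inj {k m : ℕ} (e : Fin k × Bool ≃ Fin m) :
    Function.Injective (fun l : Fin k => ({e (l, false), e (l, true)} : Finset (Fin m))) := by
  intro l l' h
  have h1 := (iss_block_mem e l (e (l, false))).2 (by simp)
  have h : ({e (l, false), e (l, true)} : Finset (Fin m)) = {e (l', false), e (l', true)} := h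
  rw [h, iss_block_mem] at h1
  simpa using h1

lemma iss_blocks_pp {k m : ℕ} (e : Fin k × Bool ≃ Fin m) : IsPairPartition (issBlocks e) := by
  refine ⟨?_, ?_, ?_⟩
  · intro p hp
    simp only [issBlocks, Finset.mem_image, Finset.mem_univ, true_and] at hp
    obtain ⟨l, rfl⟩ := hp
    exact Finset.card_pair (by simp)
  · intro p hp q hq hpq
    simp only [issBlocks, Finset.mem_image, Finset.mem_univ, true_and] at hp hq
    obtain ⟨l, rfl⟩ := hp
    obtain ⟨l', rfl⟩ := hq
    rw [Finset.disjoint_left]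
    intro x hx hx'
    rw [iss_block_mem] at hx hx'
    exact hpq (by rw [← hx, ← hx'])
  · ext x
    simp only [Finset.mem_biUnion, issBlocks, Finset.mem_image, Finset.mem_univ, true_and, id,
      iff_true]
    exact ⟨_, ⟨(e.symm x).1, rfl⟩, (iss_block_mem e _ x).2 rfl⟩

lemma iss_exists {k : ℕ} (P : Finset (Finset (Fin (2 * k)))) (hP : IsPairPartition P) :
    ∃ e : Fin k × Bool ≃ Fin (2 * k), issBlocks e = P := by
  obtain ⟨h1, h2, h3⟩ := hP
  have hcard : P.card = k := by
    have := Finset.card_biUnion (s := P) (t := id) (fun p hp q hq h => h2 p hp q hq h)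
    rw [h3, Finset.sum_congr (g := fun _ => 2) rfl (fun p hp => by simpa using h1 p hp)] at this
    simp at this
    omega
  let g : Fin k ≃ P := (P.equivFinOfCardEq hcard).symm
  have hg : ∀ l, ∃ x y, x ≠ y ∧ (g l : Finset (Fin (2 * k))) = {x, y} := fun l =>
    Finset.card_eq_two.1 (h1 _ (g l).2)
  choose x y hxy hgl using hg
  let f : Fin k × Bool → Fin (2 * k) := fun q => if q.2 then y q.1 else x q.1
  have hf : Function.Bijective f := by
    rw [Fintype.bijective_iff_surjective_and_card]
    refine ⟨?_, by simp; ring⟩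
    intro z
    have hz : z ∈ P.biUnion id := by rw [h3]; simp
    simp only [Finset.mem_biUnion, id] at hz
    obtain ⟨p, hp, hzp⟩ := hz
    obtain ⟨l, hl⟩ := g.surjective ⟨p, hp⟩
    have := hgl l
    rw [hl] at this
    simp only at this
    rw [this] at hzp
    simp only [Finset.mem_insert, Finset.mem_singleton] at hzp
    rcases hzp with h | h
    · exact ⟨(l, false), by simp [f, h]⟩
    · exact ⟨(l, true), by simp [f, h]⟩
  refine ⟨Equiv.ofBijective f hf, ?_⟩
  ext p
  simp only [issBlocks, Finset.mem_image, Finset.mem_univ, true_and, Equiv.ofBijective_apply]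
  have hb : ∀ l, ({f (l, false), f (l, true)} : Finset (Fin (2 * k))) = g l := by
    intro l; rw [hgl l]; simp [f]
  constructor
  · rintro ⟨l, rfl⟩
    rw [hb]; exact (g l).2
  · intro hp
    obtain ⟨l, hl⟩ := g.surjective ⟨p, hp⟩
    exact ⟨l, by rw [hb, hl]⟩

lemma iss_fiber {k m : ℕ} (e₀ : Fin k × Bool ≃ Fin m) :
    (Finset.univ.filter (fun e : Fin k × Bool ≃ Fin m => issBlocks e = issBlocks e₀)).card
      = k.factorial * 2 ^ k := by
  have hc : Fintype.card (Equiv.Perm (Fin k) × (Fin k → Equiv.Perm Bool))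
      = k.factorial * 2 ^ k := by
    simp [Fintype.card_perm]
  rw [← hc, ← Finset.card_univ]
  symm
  apply Finset.card_bij (fun q _ => (Equiv.prodShear q.1 q.2).trans e₀)
  · rintro ⟨g, h⟩ _
    simp only [Finset.mem_filter, Finset.mem_univ, true_and]
    have hb : ∀ l, ({e₀ (g l, h l false), e₀ (g l, h l true)} : Finset (Fin m))
        = {e₀ (g l, false), e₀ (g l, true)} := by
      intro l
      have hne : h l false ≠ h l true := by simp
      rcases hA : h l false <;> rcases hB : h l true <;> simp_all [Finset.pair_comm]
    ext p
    simp only [issBlocks, Finset.mem_image, Finset.mem_univ, true_and, Equiv.trans_apply,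
      Equiv.prodShear_apply, hb]
    exact g.surjective.exists (p := fun l => {e₀ (l, false), e₀ (l, true)} = p).symm
  · rintro ⟨g, h⟩ _ ⟨g', h'⟩ _ heq
    have h1 : ∀ l b, (g l, h l b) = (g' l, h' l b) := by
      intro l b
      have := congrArg (fun e => e (l, b)) heq
      simpa using this
    simp only [Prod.mk.injEq] at h1 ⊢
    exact ⟨Equiv.ext fun l => (h1 l false).1, funext fun l => Equiv.ext fun b => (h1 l b).2⟩
  · intro e he
    simp only [Finset.mem_filter, Finset.mem_univ, true_and] at he
    have hl : ∀ l, ∃ l', ({e₀ (l', false), e₀ (l', true)} : Finset (Fin m))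
        = {e (l, false), e (l, true)} := by
      intro l
      have : ({e (l, false), e (l, true)} : Finset (Fin m)) ∈ issBlocks e₀ := by
        rw [← he]; exact Finset.mem_image_of_mem _ (Finset.mem_univ l)
      simpa [issBlocks] using this
    choose g hg using hl
    have hfst : ∀ l b, (e₀.symm (e (l, b))).1 = g l := by
      intro l b
      rw [← iss_block_mem, hg, iss_block_mem]; simp
    have hgb : Function.Bijective g := by
      rw [← Finite.surjective_iff_bijective]
      intro l
      refine ⟨(e.symm (e₀ (l, false))).1, ?_⟩
      rw [← hfst _ (e.symm (e₀ (l, false))).2]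
      simp
    have hhb : ∀ l, Function.Bijective (fun b => (e₀.symm (e (l, b))).2) := by
      intro l
      rw [← Finite.injective_iff_bijective]
      intro b b' hbb
      have : e₀.symm (e (l, b)) = e₀.symm (e (l, b')) :=
        Prod.ext ((hfst l b).trans (hfst l b').symm) hbb
      simpa using this
    refine ⟨(Equiv.ofBijective g hgb, fun l => Equiv.ofBijective _ (hhb l)), Finset.mem_univ _, ?_⟩
    ext1 ⟨l, b⟩
    simp only [Equiv.trans_apply, Equiv.prodShear_apply, Equiv.ofBijective_apply]
    rw [← hfst l b]
    simp

lemma iss_count (k : ℕ) (w : Finset (Fin (2 * k)) → ℝ) :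
    ∑ e : Fin k × Bool ≃ Fin (2 * k), ∏ l, w {e (l, false), e (l, true)}
      = (k.factorial * 2 ^ k : ℝ) * ∑ P ∈ Finset.univ.filter
            (fun P : Finset (Finset (Fin (2 * k))) => IsPairPartition P), ∏ p ∈ P, w p := by
  rw [← Finset.sum_fiberwise_of_maps_to (s := Finset.univ) (g := issBlocks)
    (t := Finset.univ.filter
            (fun P : Finset (Finset (Fin (2 * k))) => IsPairPartition P))
    (fun e _ => by simpa using iss_blocks_pp e), Finset.mul_sum]
  apply Finset.sum_congr rfl
  intro P hP
  simp only [Finset.mem_filter, Finset.mem_univ, true_and] at hP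
  obtain ⟨e₀, rfl⟩ := iss_exists P hP
  rw [Finset.sum_congr rfl (g := fun _ => ∏ p ∈ issBlocks e₀, w p), Finset.sum_const, iss_fiber]
  · simp
  · intro e he
    simp only [Finset.mem_filter, Finset.mem_univ, true_and] at he
    rw [← he, issBlocks, Finset.prod_image (fun a _ b _ h => iss_block_inj e h)]

/-- **Isserlis' theorem, even case.** If `(X_1, …, X_{2k})` is a
centered Gaussian random vector in `ℝ^{2k}` (every real linear combination of the
entries is a centered real Gaussian), then
`E[X_1 ⋯ X_{2k}] = Σ_P Π_{{i,j} ∈ P} E[X_i X_j]`, the sum being over all partitions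
`P` of `{1, …, 2k}` into unordered pairs. -/
theorem stmt5 {Ω : Type*} [MeasurableSpace Ω] (μ : Measure Ω) [IsProbabilityMeasure μ]
    (k : ℕ) (hk : 1 ≤ k) (X : Fin (2 * k) → Ω → ℝ)
    (hmeas : ∀ i, Measurable (X i))
    (hgauss : ∀ c : Fin (2 * k) → ℝ, ∃ v : ℝ≥0,
      Measure.map (fun ω => ∑ i, c i * X i ω) μ = gaussianReal 0 v) :
    (∫ ω, ∏ i, X i ω ∂μ)
      = ∑ P ∈ Finset.univ.filter
            (fun P : Finset (Finset (Fin (2 * k))) => IsPairPartition P),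
          ∏ p ∈ P, ∫ ω, ∏ i ∈ p, X i ω ∂μ := by
  have hlaw : ∀ S : Finset (Fin (2 * k)), ∃ v : ℝ≥0,
      Measure.map (fun ω => ∑ i ∈ S, X i ω) μ = gaussianReal 0 v := by
    intro S
    obtain ⟨v, hv⟩ := hgauss (fun i => if i ∈ S then 1 else 0)
    exact ⟨v, by simpa using hv⟩
  have hmS : ∀ S : Finset (Fin (2 * k)), Measurable (fun ω => ∑ i ∈ S, X i ω) :=
    fun S => Finset.measurable_fun_sum S (fun i _ => hmeas i)
  have hLp : ∀ (S : Finset (Fin (2 * k))) (p : ℝ≥0),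
      MemLp (fun ω => ∑ i ∈ S, X i ω) p μ := by
    intro S p
    obtain ⟨v, hv⟩ := hlaw S
    have h := memLp_id_gaussianReal (μ := 0) (v := v) p
    rw [← hv] at h
    exact h.comp_of_map (hmS S).aemeasurable
  have hpow : ∀ (S : Finset (Fin (2 * k))) (n : ℕ),
      Integrable (fun ω => (∑ i ∈ S, X i ω) ^ n) μ := by
    intro S n
    have := (hLp S n).integrable_norm_pow' 
    rw [← integrable_norm_iff (((hmS S).pow_const n).aestronglyMeasurable)]
    simpa using this
  have hX2 : ∀ i, MemLp (X i) 2 μ := by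
    intro i
    have := hLp {i} 2
    simpa using this
  set C : Fin (2 * k) → Fin (2 * k) → ℝ := fun i j => ∫ ω, X i ω * X j ω ∂μ with hC
  have hint : ∀ i j, Integrable (fun ω => X i ω * X j ω) μ :=
    fun i j => (hX2 i).integrable_mul (hX2 j)
  have hmom : ∀ S : Finset (Fin (2 * k)),
      (∫ ω, (∑ i ∈ S, X i ω) ^ (2 * k) ∂μ) * (2 ^ k * (k.factorial : ℝ))
        = ((2 * k).factorial : ℝ) * (∑ i ∈ S, ∑ j ∈ S, C i j) ^ k := by
    intro S
    obtain ⟨v, hv⟩ := hlaw S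
    have hn : ∀ n : ℕ, ∫ ω, (∑ i ∈ S, X i ω) ^ n ∂μ = ∫ x, x ^ n ∂(gaussianReal 0 v) := by
      intro n
      rw [← hv, integral_map (hmS S).aemeasurable (by fun_prop)]
    have hv1 : (v : ℝ) = ∑ i ∈ S, ∑ j ∈ S, C i j := by
      have h2 := iss_moment v 1
      rw [← hn] at h2
      have h3 : ∫ ω, (∑ i ∈ S, X i ω) ^ (2 * 1) ∂μ = ∑ i ∈ S, ∑ j ∈ S, C i j := by
        simp_rw [mul_one, sq, Finset.sum_mul_sum]
        rw [integral_finsetSum _ (fun i _ => integrable_finsetSum _ (fun j _ => hint i j))]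
        apply Finset.sum_congr rfl
        intro i _
        rw [integral_finsetSum _ (fun j _ => hint i j)]
      rw [h3] at h2
      norm_num [Nat.factorial] at h2
      linarith
    rw [hn, iss_moment, hv1]
  have hpt : ∀ ω, ((2 * k).factorial : ℝ) * ∏ i, X i ω
      = ∑ S : Finset (Fin (2 * k)), (-1 : ℝ) ^ (Sᶜ).card * (∑ i ∈ S, X i ω) ^ (2 * k) := by
    intro ω
    have h := iss_polar (κ := Fin (2 * k)) (ι := Fin (2 * k)) rfl (fun f => ∏ l, X (f l) ω)
    simp_rw [← iss_pow_one (κ := Fin (2 * k)) _ (fun i => X i ω), Fintype.card_fin] at h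
    rw [h, Finset.sum_congr rfl (g := fun _ => ∏ i, X i ω)
      (fun e _ => Equiv.prod_comp e (fun i => X i ω))]
    simp [Fintype.card_perm]
  have hE : ((2 * k).factorial : ℝ) * ∫ ω, ∏ i, X i ω ∂μ
      = ∑ S : Finset (Fin (2 * k)), (-1 : ℝ) ^ (Sᶜ).card *
        ∫ ω, (∑ i ∈ S, X i ω) ^ (2 * k) ∂μ := by
    rw [← integral_const_mul]
    simp_rw [hpt]
    rw [integral_finsetSum _ (fun S _ => (hpow S _).const_mul _)]
    simp_rw [integral_const_mul]
  have hcomb : ∑ S : Finset (Fin (2 * k)), (-1 : ℝ) ^ (Sᶜ).card * (∑ i ∈ S, ∑ j ∈ S, C i j) ^ k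
      = (k.factorial * 2 ^ k : ℝ) * ∑ P ∈ Finset.univ.filter
            (fun P : Finset (Finset (Fin (2 * k))) => IsPairPartition P),
          ∏ p ∈ P, ∫ ω, ∏ i ∈ p, X i ω ∂μ := by
    simp_rw [iss_pow_two]
    rw [iss_polar (by simp; ring) (fun f : Fin k × Bool → Fin (2 * k) =>
      ∏ l, C (f (l, false)) (f (l, true))), ← iss_count]
    apply Finset.sum_congr rfl
    intro e _
    apply Finset.prod_congr rfl
    intro l _
    have hne : e (l, false) ≠ e (l, true) := by simp
    simp_rw [Finset.prod_pair hne]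
    rfl
  have hfin : ((2 * k).factorial : ℝ) * (k.factorial * 2 ^ k : ℝ) * ∫ ω, ∏ i, X i ω ∂μ
      = ((2 * k).factorial : ℝ) * (k.factorial * 2 ^ k : ℝ) * ∑ P ∈ Finset.univ.filter
            (fun P : Finset (Finset (Fin (2 * k))) => IsPairPartition P),
          ∏ p ∈ P, ∫ ω, ∏ i ∈ p, X i ω ∂μ := by
    rw [mul_assoc _ _ (Finset.sum _ _), ← hcomb, mul_right_comm, hE, Finset.sum_mul,
      Finset.mul_sum]
    apply Finset.sum_congr rfl
    intro S _
    linear_combination ((-1 : ℝ) ^ (Sᶜ).card) * hmom S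
  exact mul_left_cancel₀ (by positivity) hfin
end

section
/- Let Z and W be complex-valued random variables such that the real random vector (Re Z, Im Z, Re W, Im W) is a centered Gaussian vector in ℝ^4, and suppose E[Z^2] = 0, E[W^2] = 0 and E[Z·W] = c for some c ∈ ℂ. Then for every integer k ≥ 1, E[Z^k · W^k] = k! · c^k. -/
open MeasureTheory ProbabilityTheory
open scoped NNReal ENNReal
open Nat in
lemma gaussMoment (v : ℝ≥0) (n : ℕ) :
    ∫ x, x ^ (2 * n) ∂(gaussianReal 0 v) = ((2 * n - 1)‼ : ℝ) * (v : ℝ) ^ n := by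
  by_cases hv : v = 0
  · subst hv
    rw [gaussianReal_zero_var, integral_dirac]
    rcases Nat.eq_zero_or_pos n with rfl | hn
    · simp
    · simp [hn.ne']
  rw [integral_gaussianReal_eq_integral_smul hv]
  have hv' : (0 : ℝ) < v := by positivity
  have h1 : ∀ x : ℝ, gaussianPDFReal 0 v x • x ^ (2 * n) =
      (√(2 * Real.pi * v))⁻¹ * ((fun y : ℝ => y ^ (2 * n : ℝ) * Real.exp (- (1 / (2 * v)) * y ^ (2:ℝ))) |x|) := by
    intro x
    have e1 : |x| ^ (2 * n : ℝ) = x ^ (2 * n) := by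
      rw [show (2 * n : ℝ) = ((2 * n : ℕ) : ℝ) by push_cast; rfl, Real.rpow_natCast, pow_mul, pow_mul,
        sq_abs]
    simp only [gaussianPDFReal, smul_eq_mul, e1]
    rw [Real.rpow_two, sq_abs, sub_zero]
    rw [show -(1 / (2 * (v:ℝ))) * x ^ 2 = -x ^ 2 / (2 * v) by ring]
    ring
  simp_rw [h1]
  have h0 : (-1 : ℝ) < 2 * n := by
    have : (0 : ℝ) ≤ n := by positivity
    linarith
  rw [integral_const_mul, integral_comp_abs
      (f := fun y : ℝ => y ^ (2 * n : ℝ) * Real.exp (- (1 / (2 * v)) * y ^ (2:ℝ))),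
    integral_rpow_mul_exp_neg_mul_rpow (by norm_num) h0 (by positivity)]
  rw [show ((2 * n + 1 : ℝ) / 2) = n + 1 / 2 by ring, Real.Gamma_nat_add_half]
  have h2 : (1 / (2 * (v:ℝ))) ^ (-(2 * n + 1 : ℝ) / 2) = (2 * v) ^ n * √(2 * v) := by
    rw [one_div, Real.inv_rpow (by positivity), ← Real.rpow_neg (by positivity),
      show (-(-(2 * n + 1 : ℝ) / 2)) = n + 1 / 2 by ring, Real.rpow_add (by positivity), Real.rpow_natCast,
      Real.sqrt_eq_rpow]
  rw [h2, show 2 * Real.pi * (v:ℝ) = (2 * v) * Real.pi by ring, Real.sqrt_mul (by positivity), mul_pow]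
  have := Real.sqrt_pos.2 Real.pi_pos
  have : 0 < √(2 * (v:ℝ)) := Real.sqrt_pos.2 (by positivity)
  field_simp

lemma powInt {Ω : Type*} [MeasurableSpace Ω] (μ : Measure Ω) [IsProbabilityMeasure μ]
    {f g : Ω → ℂ} (hf : ∀ p : ℕ, MemLp f p μ) (hg : ∀ p : ℕ, MemLp g p μ) (a b : ℕ) :
    Integrable (fun ω => f ω ^ a * g ω ^ b) μ := by
  have key : ∀ (h : Ω → ℂ), (∀ p : ℕ, MemLp h p μ) → ∀ a : ℕ, Integrable (fun ω => ‖h ω‖ ^ (2 * a)) μ := by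
    intro h hh a
    exact (hh (2 * a)).integrable_norm_pow' 
  refine Integrable.mono' ((key f hf a).add (key g hg b))
    (((hf 1).1.pow a).mul ((hg 1).1.pow b)) (.of_forall fun ω => ?_)
  simp only [norm_mul, norm_pow, Pi.add_apply, pow_mul']
  nlinarith [sq_nonneg (‖f ω‖ ^ a - ‖g ω‖ ^ b), sq_nonneg (‖f ω‖ ^ a), sq_nonneg (‖g ω‖ ^ b)]

open Polynomial in
lemma polyMom {Ω : Type*} [MeasurableSpace Ω] (μ : Measure Ω) [IsProbabilityMeasure μ]
    {f g : Ω → ℂ} (hf : ∀ p : ℕ, MemLp f p μ) (hg : ∀ p : ℕ, MemLp g p μ) (n : ℕ) :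
    ∃ P : ℂ[X], (∀ t : ℂ, ∫ ω, (t * g ω + f ω) ^ n ∂μ = P.eval t) ∧
      ∀ j ≤ n, P.coeff j = n.choose j * ∫ ω, f ω ^ (n - j) * g ω ^ j ∂μ := by
  refine ⟨∑ j ∈ Finset.range (n + 1), C (n.choose j * ∫ ω, f ω ^ (n - j) * g ω ^ j ∂μ) * X ^ j,
    fun t => ?_, fun j hj => ?_⟩
  · simp_rw [add_pow]
    rw [integral_finsetSum]
    · rw [eval_finsetSum]
      refine Finset.sum_congr rfl fun j _ => ?_
      simp only [eval_mul, eval_C, eval_pow, eval_X]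
      rw [mul_comm, ← mul_assoc, ← integral_const_mul]
      congr 1; ext ω
      ring
    · intro j _
      convert (powInt μ hf hg (n - j) j).const_mul (t ^ j * n.choose j) using 2
      ring
  · simp only [finsetSum_coeff, coeff_C_mul_X_pow]
    rw [Finset.sum_ite_eq, if_pos (by simp; omega)]

open Polynomial in
lemma polyEq (P Q : ℂ[X]) (h : ∀ t : ℝ, P.eval (t : ℂ) = Q.eval (t : ℂ)) : P = Q := by
  apply eq_of_infinite_eval_eq
  refine (Set.infinite_range_of_injective Complex.ofReal_injective).mono ?_
  rintro _ ⟨t, rfl⟩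
  exact h t

open Nat Polynomial in
/-- complex combination of two jointly Gaussian reals -/
lemma cplxMom {Ω : Type*} [MeasurableSpace Ω] (μ : Measure Ω) [IsProbabilityMeasure μ]
    {U V : Ω → ℝ} (hU : Measurable U) (hV : Measurable V)
    (hf : ∀ p : ℕ, MemLp (fun ω => (U ω : ℂ)) p μ) (hg : ∀ p : ℕ, MemLp (fun ω => (V ω : ℂ)) p μ)
    (h : ∀ t : ℝ, ∃ v : ℝ≥0, Measure.map (fun ω => t * V ω + U ω) μ = gaussianReal 0 v) (n : ℕ) :
    ∫ ω, (Complex.I * V ω + U ω) ^ (2 * n) ∂μ =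
      ((2 * n - 1)‼ : ℂ) * (∫ ω, (Complex.I * V ω + U ω) ^ 2 ∂μ) ^ n := by
  obtain ⟨P, hP, -⟩ := polyMom μ hf hg (2 * n)
  obtain ⟨Q, hQ, -⟩ := polyMom μ hf hg 2
  have : P = C ((2 * n - 1)‼ : ℂ) * Q ^ n := by
    apply polyEq
    intro t
    rw [eval_mul, eval_C, eval_pow, ← hP, ← hQ]
    obtain ⟨v, hv⟩ := h t
    have hm : ∀ m : ℕ, ∫ ω, ((t : ℂ) * V ω + U ω) ^ m ∂μ = ((∫ x, x ^ m ∂(gaussianReal 0 v) : ℝ) : ℂ) := by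
      intro m
      rw [← hv, integral_map (by fun_prop) (by fun_prop), ← integral_complex_ofReal]
      push_cast; rfl
    rw [hm, hm, gaussMoment]
    have := gaussMoment v 1
    norm_num at this
    rw [this]
    push_cast; rfl
  rw [hP, hQ, this]; simp

/-- Let `Z, W` be complex random variables such that
`(Re Z, Im Z, Re W, Im W)` is a centered Gaussian vector in `ℝ^4` (every real linear
combination of these four entries is a centered real Gaussian). If `E[Z^2] = 0`,
`E[W^2] = 0` and `E[Z·W] = c`, then for every `k ≥ 1`, `E[Z^k · W^k] = k! · c^k`. -/
theorem stmt6 {Ω : Type*} [MeasurableSpace Ω] (μ : Measure Ω) [IsProbabilityMeasure μ]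
    (Z W : Ω → ℂ) (hZmeas : Measurable Z) (hWmeas : Measurable W)
    (hgauss : ∀ c : Fin 4 → ℝ, ∃ v : ℝ≥0,
      Measure.map (fun ω =>
        c 0 * (Z ω).re + c 1 * (Z ω).im + c 2 * (W ω).re + c 3 * (W ω).im) μ
        = gaussianReal 0 v)
    (hZ2 : (∫ ω, (Z ω) ^ 2 ∂μ) = 0)
    (hW2 : (∫ ω, (W ω) ^ 2 ∂μ) = 0)
    (c : ℂ) (hZW : (∫ ω, Z ω * W ω ∂μ) = c)
    (k : ℕ) (hk : 1 ≤ k) :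
    (∫ ω, (Z ω) ^ k * (W ω) ^ k ∂μ) = (k.factorial : ℂ) * c ^ k := by
  have hreal : ∀ (X : Ω → ℝ), Measurable X →
      (∃ v : ℝ≥0, Measure.map X μ = gaussianReal 0 v) →
      ∀ p : ℕ, MemLp (fun ω => (X ω : ℂ)) p μ := by
    rintro X hX ⟨v, hv⟩ p
    have h1 : MemLp id (p : ℝ≥0∞) (Measure.map X μ) := by
      rw [hv]
      exact memLp_id_gaussianReal' _ (by simp)
    have h2 := (memLp_map_measure_iff (by fun_prop) hX.aemeasurable).1 h1
    exact h2.ofReal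
  have hUm : ∀ s : ℝ, Measurable fun ω => (Z ω).re + s * (W ω).re := fun s => by fun_prop
  have hVm : ∀ s : ℝ, Measurable fun ω => (Z ω).im + s * (W ω).im := fun s => by fun_prop
  have hU : ∀ s : ℝ, ∀ p : ℕ, MemLp (fun ω => (((Z ω).re + s * (W ω).re : ℝ) : ℂ)) p μ := by
    intro s
    refine hreal _ (hUm s) ?_
    simpa using hgauss ![1, 0, s, 0]
  have hV : ∀ s : ℝ, ∀ p : ℕ, MemLp (fun ω => (((Z ω).im + s * (W ω).im : ℝ) : ℂ)) p μ := by
    intro s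
    refine hreal _ (hVm s) ?_
    simpa using hgauss ![0, 1, 0, s]
  have hlin : ∀ (s : ℝ) (ω : Ω), Complex.I * (((Z ω).im + s * (W ω).im : ℝ) : ℂ) +
      (((Z ω).re + s * (W ω).re : ℝ) : ℂ) = s * W ω + Z ω := by
    intro s ω
    apply Complex.ext <;> simp <;> ring
  have hS : ∀ s : ℝ, ∀ p : ℕ, MemLp (fun ω => s * W ω + Z ω) p μ := by
    intro s p
    have := ((hV s p).const_mul Complex.I).add (hU s p)
    refine this.congr_norm (by fun_prop) (.of_forall fun ω => ?_)
    simp only [Pi.add_apply]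
    rw [hlin]
  have hZL : ∀ p : ℕ, MemLp Z p μ := fun p => by simpa using hS 0 p
  have hWL : ∀ p : ℕ, MemLp W p μ := fun p => by
    have := (hS 1 p).sub (hZL p)
    refine this.congr_norm (by fun_prop) (.of_forall fun ω => ?_)
    simp
  have hmom : ∀ s : ℝ, ∫ ω, (s * W ω + Z ω) ^ (2 * k) ∂μ =
      ((2 * k - 1).doubleFactorial : ℂ) * (∫ ω, (s * W ω + Z ω) ^ 2 ∂μ) ^ k := by
    intro s
    have := cplxMom μ (hUm s) (hVm s) (hU s) (hV s) (fun t => by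
      obtain ⟨v, hv⟩ := hgauss ![1, t, s, t * s]
      refine ⟨v, hv ▸ ?_⟩
      congr 1
      ext ω
      simp
      ring) k
    simpa only [hlin] using this
  have hsq : ∀ s : ℝ, ∫ ω, ((s : ℂ) * W ω + Z ω) ^ 2 ∂μ = 2 * c * s := by
    intro s
    have i1 : Integrable (fun ω => (s : ℂ) ^ 2 * W ω ^ 2) μ := by
      simpa using (powInt μ hZL hWL 0 2).const_mul ((s : ℂ) ^ 2)
    have i2 : Integrable (fun ω => (2 * s : ℂ) * (Z ω * W ω)) μ := by
      simpa using (powInt μ hZL hWL 1 1).const_mul (2 * s : ℂ)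
    have i3 : Integrable (fun ω => Z ω ^ 2) μ := by
      simpa using powInt μ hZL hWL 2 0
    have e : ∀ ω, ((s : ℂ) * W ω + Z ω) ^ 2 =
        (s : ℂ) ^ 2 * W ω ^ 2 + (2 * s : ℂ) * (Z ω * W ω) + Z ω ^ 2 := fun ω => by ring
    simp_rw [e]
    rw [integral_add (by exact i1.add i2) i3, integral_add i1 i2, integral_const_mul, integral_const_mul,
      hZ2, hW2, hZW]
    ring
  obtain ⟨P, hP, hPc⟩ := polyMom μ hZL hWL (2 * k)
  have hPeq : P = Polynomial.C (((2 * k - 1).doubleFactorial : ℂ) * (2 * c) ^ k) *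
      Polynomial.X ^ k := by
    apply polyEq
    intro s
    rw [← hP, hmom, hsq]
    simp only [Polynomial.eval_mul, Polynomial.eval_C, Polynomial.eval_pow, Polynomial.eval_X]
    ring
  have hc := hPc k (by omega)
  rw [hPeq, Polynomial.coeff_C_mul_X_pow, if_pos rfl, show 2 * k - k = k by omega] at hc
  have hne : ((2 * k).choose k : ℂ) ≠ 0 := by
    exact_mod_cast (Nat.centralBinom_ne_zero k)
  have hcomb : (2 * k).choose k * k.factorial = (2 * k - 1).doubleFactorial * 2 ^ k := by
    have h1 := Nat.choose_mul_factorial_mul_factorial (show k ≤ 2 * k by omega)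
    rw [show 2 * k - k = k by omega] at h1
    have h2 := Nat.factorial_eq_mul_doubleFactorial (2 * k - 1)
    rw [show 2 * k - 1 + 1 = 2 * k by omega, Nat.doubleFactorial_two_mul] at h2
    apply Nat.eq_of_mul_eq_mul_right (Nat.factorial_pos k)
    rw [h1, h2]
    ring
  have hcomb' : ((2 * k).choose k : ℂ) * k.factorial =
      ((2 * k - 1).doubleFactorial : ℂ) * 2 ^ k := by exact_mod_cast hcomb
  apply mul_left_cancel₀ hne
  rw [← hc, ← mul_assoc, hcomb']
  ring
end
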